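/- Let k ∈ ℕ and δ ∉ 𝒞_k = {−p/(2(n+1)) : p = 0,…,2k−2}. The Casimir operator C^k_δ of the Lie algebra sp_{2n+2} of infinitesimal projective contact transformations acting on R^k_δ, defined (via the Killing-dual bases) by C^k_δ = −(1/(8(n+2)))(L_{X_1}∘L_{X_{t²}} + L_{X_{t²}}∘L_{X_1}) + (1/(4(n+2)))(L_{X_t})² − (1/(4(n+2)))Σ_i(L_{X_{q^i}}∘L_{X_{tp_i}} + L_{X_{tp_i}}∘L_{X_{q^i}}) + (1/(4(n+2)))Σ_i(L_{X_{p_i}}∘L_{X_{tq^i}} + L_{X_{tq^i}}∘L_{X_{p_i}}) − (1/(8(n+2)))Σ_i(L_{X_{q^{i}q^{i}}}∘L_{X_{p_ip_i}} + L_{X_{p_ip_i}}∘L_{X_{q^{i}q^{i}}}) − (1/(4(n+2)))Σ_{i<j}(L_{X_{q^iq^j}}∘L_{X_{p_ip_j}} + L_{X_{p_ip_j}}∘L_{X_{q^iq^j}}) + (1/(4(n+2)))Σ_{i,j}L_{X_{p_iq^j}}∘L_{X_{p_jq^i}}, satisfies C^k_δ = (1/(n+2))(c(k,δ)·id + X ∘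 i_α), where c(k,δ) = (n+1)²δ² − (n+1)²δ + k(n+1)δ + (k²−k)/2. -/

import Mathlib

open scoped BigOperators

noncomputable section

/-- Points of `ℝ^{2n+1}`. -/
abbrev Vc (n : ℕ) : Type := Fin (2*n+1) → ℝ

/-- Partial derivative of `f : ℝ^ι → ℝ` in the `i`-th coordinate direction. -/
def pd {ι : Type*} [Fintype ι] [DecidableEq ι] (i : ι) (f : (ι → ℝ) → ℝ) (x : ι → ℝ) : ℝ :=
  fderiv ℝ f x (Pi.single i 1)

/-- Index of the coordinate `p_i` in `ℝ^{2n+1}`. -/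
def pIdx (n : ℕ) (i : Fin n) : Fin (2*n+1) := ⟨i.1, by have := i.isLt; omega⟩
/-- Index of the coordinate `q^i` in `ℝ^{2n+1}`. -/
def qIdx (n : ℕ) (i : Fin n) : Fin (2*n+1) := ⟨n + i.1, by have := i.isLt; omega⟩
/-- Index of the coordinate `t` in `ℝ^{2n+1}`. -/
def tIdx (n : ℕ) : Fin (2*n+1) := ⟨2*n, by omega⟩

/-- The contact Hamiltonian vector field `X_h` of a function `h` on `ℝ^{2n+1}`. -/
def contactHam (n : ℕ) (h : Vc n → ℝ) (x : Vc n) : Vc n :=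
  fun a =>
    if ha : a.1 < n then
      -pd (qIdx n ⟨a.1, ha⟩) h x - pd (tIdx n) h x * x a
    else if ha' : a.1 < 2*n then
      pd (pIdx n ⟨a.1 - n, by omega⟩) h x - pd (tIdx n) h x * x a
    else
      (∑ k : Fin n, (x (pIdx n k) * pd (pIdx n k) h x + x (qIdx n k) * pd (qIdx n k) h x))
        - 2 * h x

/-- Base partial derivative `∂_i S` of a symbol `S(x;ξ)`. -/
def pdB (n : ℕ) (i : Fin (2*n+1)) (S : Vc n → Vc n → ℝ) (x ξ : Vc n) : ℝ :=
  fderiv ℝ (fun y => S y ξ) x (Pi.single i 1)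

/-- Fiber partial derivative `∂_{ξ_i} S` of a symbol `S(x;ξ)`. -/
def pdF (n : ℕ) (i : Fin (2*n+1)) (S : Vc n → Vc n → ℝ) (x ξ : Vc n) : ℝ :=
  fderiv ℝ (fun ζ => S x ζ) ξ (Pi.single i 1)

/-- `S` belongs to `R^k_δ`: a smooth map from `ℝ^{2n+1}` into homogeneous polynomials of
degree `k` in the fiber variables `ξ` (the density weight `δ + k/(n+1)` is recorded
through the actions and operators below). -/
def InR (n k : ℕ) (S : Vc n → Vc n → ℝ) : Prop :=
  ContDiff ℝ (⊤ : ℕ∞) (fun p : Vc n × Vc n => S p.1 p.2) ∧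
  ∀ (x : Vc n) (c : ℝ) (ξ : Vc n), S x (c • ξ) = c ^ k * S x ξ

/-- The vertical cotangent lift of the contact form:
`i_α = (1/2)(Σ_j (p_j ∂_{ξ_{q^j}} − q^j ∂_{ξ_{p_j}}) − ∂_{ξ_t})`. -/
def iAlpha (n : ℕ) (S : Vc n → Vc n → ℝ) (x ξ : Vc n) : ℝ :=
  (1/2) * ((∑ j : Fin n, (x (pIdx n j) * pdF n (qIdx n j) S x ξ
      - x (qIdx n j) * pdF n (pIdx n j) S x ξ)) - pdF n (tIdx n) S x ξ)

/-- The generalized contact Hamiltonian with weight constant `a` (equal to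
`2(n+1)δ + k` on `R^k_δ`):
`X(S) = Σ_j (ξ_{q^j}∂_{p_j}S − ξ_{p_j}∂_{q^j}S) + ξ_t ℰ_s S − ⟨ℰ_s,ξ_s⟩∂_t S + a ξ_t S`. -/
def genHam (n : ℕ) (a : ℝ) (S : Vc n → Vc n → ℝ) (x ξ : Vc n) : ℝ :=
  (∑ j : Fin n, (ξ (qIdx n j) * pdB n (pIdx n j) S x ξ
      - ξ (pIdx n j) * pdB n (qIdx n j) S x ξ))
  + ξ (tIdx n) * (∑ j : Fin n, (x (pIdx n j) * pdB n (pIdx n j) S x ξ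
      + x (qIdx n j) * pdB n (qIdx n j) S x ξ))
  - (∑ j : Fin n, (x (pIdx n j) * ξ (pIdx n j) + x (qIdx n j) * ξ (qIdx n j)))
      * pdB n (tIdx n) S x ξ
  + a * ξ (tIdx n) * S x ξ

/-- `ℓ`-fold iteration `X^ℓ` of the generalized Hamiltonian, starting with weight
constant `a` and increasing it by `1` at each step. -/
def genHamPow (n : ℕ) (a : ℝ) : ℕ → (Vc n → Vc n → ℝ) → (Vc n → Vc n → ℝ)
  | 0, S => S
  | ℓ+1, S => genHam n (a + ℓ) (genHamPow n a ℓ S)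

/-- The action of a vector field `Xf` on `R^k_δ` with weight `w = δ + k/(n+1)`:
`L_{X}S = X(S) − Σ_{i,j}∂_jX^i ξ_i ∂_{ξ_j}S + w (div X) S`. -/
def LAct (n : ℕ) (w : ℝ) (Xf : Vc n → Vc n) (S : Vc n → Vc n → ℝ) (x ξ : Vc n) : ℝ :=
  (∑ i, Xf x i * pdB n i S x ξ)
  - (∑ i, ∑ j, pd j (fun y => Xf y i) x * ξ i * pdF n j S x ξ)
  + w * (∑ i, pd i (fun y => Xf y i) x) * S x ξ

/-- Contact Hamiltonians of the generators of `sp_{2n+2}`: the functions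
`1, p_i, q^i, t, p_ip_j, q^iq^j, p_jq^i, tp_i, tq^i, t²`. -/
def IsGen (n : ℕ) (h : Vc n → ℝ) : Prop :=
  h = (fun _ => 1) ∨
  (∃ i, h = fun x => x (pIdx n i)) ∨
  (∃ i, h = fun x => x (qIdx n i)) ∨
  h = (fun x => x (tIdx n)) ∨
  (∃ i j, h = fun x => x (pIdx n i) * x (pIdx n j)) ∨
  (∃ i j, h = fun x => x (qIdx n i) * x (qIdx n j)) ∨
  (∃ i j, h = fun x => x (pIdx n j) * x (qIdx n i)) ∨
  (∃ i, h = fun x => x (tIdx n) * x (pIdx n i)) ∨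
  (∃ i, h = fun x => x (tIdx n) * x (qIdx n i)) ∨
  h = (fun x => x (tIdx n) * x (tIdx n))

/-- The action `L_{X_h}` on `R^k_δ` of the contact Hamiltonian field of `h`. -/
def Lgen (n k : ℕ) (δ : ℝ) (h : Vc n → ℝ) (S : Vc n → Vc n → ℝ) : Vc n → Vc n → ℝ :=
  LAct n (δ + (k : ℝ)/((n : ℝ)+1)) (contactHam n h) S

/-- The Casimir operator `C^k_δ` of `sp_{2n+2}` acting on `R^k_δ`, written by means of the
Killing-dual bases of `sp_{2n+2}`. -/
def casimirOp (n k : ℕ) (δ : ℝ) (S : Vc n → Vc n → ℝ) (x ξ : Vc n) : ℝ :=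
  let L := Lgen n k δ
  let one : Vc n → ℝ := fun _ => 1
  let tf : Vc n → ℝ := fun x => x (tIdx n)
  let t2 : Vc n → ℝ := fun x => x (tIdx n) * x (tIdx n)
  let pf : Fin n → Vc n → ℝ := fun i x => x (pIdx n i)
  let qf : Fin n → Vc n → ℝ := fun i x => x (qIdx n i)
  let tp : Fin n → Vc n → ℝ := fun i x => x (tIdx n) * x (pIdx n i)
  let tq : Fin n → Vc n → ℝ := fun i x => x (tIdx n) * x (qIdx n i)
  let pp : Fin n → Fin n → Vc n → ℝ := fun i j x => x (pIdx n i) * x (pIdx n j)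
  let qq : Fin n → Fin n → Vc n → ℝ := fun i j x => x (qIdx n i) * x (qIdx n j)
  let pq : Fin n → Fin n → Vc n → ℝ := fun i j x => x (pIdx n i) * x (qIdx n j)
  (-(1:ℝ)/(8*((n:ℝ)+2))) * (L one (L t2 S) x ξ + L t2 (L one S) x ξ)
  + (1/(4*((n:ℝ)+2))) * L tf (L tf S) x ξ
  - (1/(4*((n:ℝ)+2))) * ∑ i, (L (qf i) (L (tp i) S) x ξ + L (tp i) (L (qf i) S) x ξ)
  + (1/(4*((n:ℝ)+2))) * ∑ i, (L (pf i) (L (tq i) S) x ξ + L (tq i) (L (pf i) S) x ξ)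
  - (1/(8*((n:ℝ)+2))) * ∑ i, (L (qq i i) (L (pp i i) S) x ξ + L (pp i i) (L (qq i i) S) x ξ)
  - (1/(4*((n:ℝ)+2))) * ∑ i, ∑ j,
      (if i < j then L (qq i j) (L (pp i j) S) x ξ + L (pp i j) (L (qq i j) S) x ξ else 0)
  + (1/(4*((n:ℝ)+2))) * ∑ i, ∑ j, L (pq i j) (L (pq j i) S) x ξ

section Index
variable {n : ℕ}

lemma pIdx_ne_qIdx (i j : Fin n) : pIdx n i ≠ qIdx n j := by
  simp only [pIdx, qIdx, ne_eq, Fin.mk.injEq]; omega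

lemma pIdx_ne_tIdx (i : Fin n) : pIdx n i ≠ tIdx n := by
  simp only [pIdx, tIdx, ne_eq, Fin.mk.injEq]; omega

lemma qIdx_ne_tIdx (i : Fin n) : qIdx n i ≠ tIdx n := by
  simp only [qIdx, tIdx, ne_eq, Fin.mk.injEq]; omega

lemma pIdx_inj {i j : Fin n} : pIdx n i = pIdx n j ↔ i = j := by
  simp [pIdx, Fin.ext_iff]

lemma qIdx_inj {i j : Fin n} : qIdx n i = qIdx n j ↔ i = j := by
  simp [qIdx, Fin.ext_iff]

lemma index_cases {motive : Fin (2 * n + 1) → Prop} (hp : ∀ i, motive (pIdx n i))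
    (hq : ∀ i, motive (qIdx n i)) (ht : motive (tIdx n)) (a : Fin (2 * n + 1)) : motive a := by
  by_cases h1 : a.1 < n
  · exact hp ⟨a.1, h1⟩
  by_cases h2 : a.1 < 2 * n
  · have : a = qIdx n ⟨a.1 - n, by omega⟩ := by simp only [qIdx, Fin.ext_iff]; omega
    exact this ▸ hq _
  · have : a = tIdx n := by simp only [tIdx, Fin.ext_iff]; omega
    exact this ▸ ht

lemma sum_index {M : Type*} [AddCommMonoid M] (f : Fin (2 * n + 1) → M) :
    ∑ a, f a = ∑ i, (f (pIdx n i) + f (qIdx n i)) + f (tIdx n) := by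
  rw [Fin.sum_univ_castSucc, Finset.sum_add_distrib]
  congr 1
  rw [← (finCongr (two_mul n)).symm.sum_comp, Fin.sum_univ_add]
  rfl

/-- The symplectic rotation `∑ (a_p, a_q) ↦ (-a_q, a_p)` of the spatial coordinates. -/
def spRot (a : Vc n) : Vc n := fun b =>
  if hb : b.1 < n then -a (qIdx n ⟨b.1, hb⟩)
  else if hb' : b.1 < 2 * n then a (pIdx n ⟨b.1 - n, by omega⟩)
  else 0

@[simp] lemma spRot_pIdx (a : Vc n) (i : Fin n) : spRot a (pIdx n i) = -a (qIdx n i) := by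
  simp [spRot, pIdx]

@[simp] lemma spRot_qIdx (a : Vc n) (i : Fin n) : spRot a (qIdx n i) = a (pIdx n i) := by
  have h1 : ¬ (n + i.1 < n) := by omega
  have h2 : n + i.1 < 2 * n := by omega
  simp [spRot, qIdx, h2]

@[simp] lemma spRot_tIdx (a : Vc n) : spRot a (tIdx n) = 0 := by
  have h1 : ¬ (2 * n < n) := by omega
  simp [spRot, tIdx, h1]

lemma contactHam_pIdx (h : Vc n → ℝ) (x : Vc n) (i : Fin n) :
    contactHam n h x (pIdx n i) = -pd (qIdx n i) h x - pd (tIdx n) h x * x (pIdx n i) := by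
  simp [contactHam, pIdx]

lemma contactHam_qIdx (h : Vc n → ℝ) (x : Vc n) (i : Fin n) :
    contactHam n h x (qIdx n i) = pd (pIdx n i) h x - pd (tIdx n) h x * x (qIdx n i) := by
  have h1 : ¬ (n + i.1 < n) := by omega
  have h2 : n + i.1 < 2 * n := by omega
  simp [contactHam, qIdx, h2]

lemma contactHam_tIdx (h : Vc n → ℝ) (x : Vc n) :
    contactHam n h x (tIdx n) = (∑ k : Fin n, (x (pIdx n k) * pd (pIdx n k) h x
      + x (qIdx n k) * pd (qIdx n k) h x)) - 2 * h x := by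
  have h1 : ¬ (2 * n < n) := by omega
  simp [contactHam, tIdx, h1]

end Index

section Calculus
variable {n : ℕ}

/-- The affine function with gradient `a` and constant term `c`. -/
def affineFn (a : Vc n) (c : ℝ) (x : Vc n) : ℝ := a ⬝ᵥ x + c

/-- The vector field `Y_u` attached to an affine function `u`, such that
`X_{uv} = u Y_v + v Y_u`. -/
def affineField (a : Vc n) (c : ℝ) (x : Vc n) : Vc n :=
  spRot a - a (tIdx n) • x - c • Pi.single (tIdx n) 1

/-- The linear form `v ↦ a ⬝ᵥ v`. -/
def dotCLM (a : Vc n) : Vc n →L[ℝ] ℝ := LinearMap.toContinuousLinearMap (dotProductBilin ℝ ℝ a)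

@[simp] lemma dotCLM_apply (a v : Vc n) : dotCLM a v = a ⬝ᵥ v := rfl

lemma hasFDerivAt_affineFn (a : Vc n) (c : ℝ) (x : Vc n) :
    HasFDerivAt (affineFn a c) (dotCLM a) x :=
  (dotCLM a).hasFDerivAt.add_const c

lemma pd_mul_affineFn (a b : Vc n) (c d : ℝ) (i : Fin (2 * n + 1)) (x : Vc n) :
    pd i (fun y => affineFn a c y * affineFn b d y) x
      = affineFn a c x * b i + affineFn b d x * a i := by
  rw [pd, fderiv_fun_mul (hasFDerivAt_affineFn a c x).differentiableAt
    (hasFDerivAt_affineFn b d x).differentiableAt, (hasFDerivAt_affineFn a c x).fderiv,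
    (hasFDerivAt_affineFn b d x).fderiv]
  simp [dotCLM]

lemma contactHam_mul (a b : Vc n) (c d : ℝ) (x : Vc n) :
    contactHam n (fun y => affineFn a c y * affineFn b d y) x
      = affineFn a c x • affineField b d x + affineFn b d x • affineField a c x := by
  have hsum : ∀ (a : Vc n) (c : ℝ), affineFn a c x
      = ∑ k, (x (pIdx n k) * a (pIdx n k) + x (qIdx n k) * a (qIdx n k))
        + a (tIdx n) * x (tIdx n) + c := by
    intro a c
    simp only [affineFn, dotProduct, sum_index, mul_comm]
  funext e
  induction e using index_cases with
  | hp i =>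
    simp [contactHam_pIdx, pd_mul_affineFn, affineField, pIdx_ne_tIdx]
    ring
  | hq i =>
    simp [contactHam_qIdx, pd_mul_affineFn, affineField, qIdx_ne_tIdx]
    ring
  | ht =>
    have key : ∑ k : Fin n, (x (pIdx n k) * (affineFn a c x * b (pIdx n k)
          + affineFn b d x * a (pIdx n k)) + x (qIdx n k) * (affineFn a c x * b (qIdx n k)
          + affineFn b d x * a (qIdx n k)))
        = affineFn a c x * (affineFn b d x - b (tIdx n) * x (tIdx n) - d)
          + affineFn b d x * (affineFn a c x - a (tIdx n) * x (tIdx n) - c) := by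
      have ha : affineFn a c x - a (tIdx n) * x (tIdx n) - c
          = ∑ k, (x (pIdx n k) * a (pIdx n k) + x (qIdx n k) * a (qIdx n k)) := by
        rw [hsum]; ring
      have hb : affineFn b d x - b (tIdx n) * x (tIdx n) - d
          = ∑ k, (x (pIdx n k) * b (pIdx n k) + x (qIdx n k) * b (qIdx n k)) := by
        rw [hsum]; ring
      rw [ha, hb, Finset.mul_sum, Finset.mul_sum, ← Finset.sum_add_distrib]
      exact Finset.sum_congr rfl fun k _ => by ring
    simp [contactHam_tIdx, pd_mul_affineFn, affineField, key]
    ring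

lemma spRot_dotProduct_swap (a b : Vc n) : spRot a ⬝ᵥ b = -(spRot b ⬝ᵥ a) := by
  simp only [dotProduct, sum_index, spRot_pIdx, spRot_qIdx, spRot_tIdx, zero_mul, add_zero,
    ← Finset.sum_neg_distrib]
  exact Finset.sum_congr rfl fun k _ => by ring

lemma hasFDerivAt_affineField_apply (a : Vc n) (c : ℝ) (x : Vc n) (i : Fin (2 * n + 1)) :
    HasFDerivAt (fun y => affineField a c y i)
      (-a (tIdx n) • ContinuousLinearMap.proj (R := ℝ) (φ := fun _ => ℝ) i) x := by
  have h := (((ContinuousLinearMap.proj (R := ℝ) (φ := fun _ : Fin (2 * n + 1) => ℝ)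
    i).hasFDerivAt (x := x)).const_mul (-a (tIdx n))).const_add
      (spRot a i - c * (Pi.single (tIdx n) 1 : Vc n) i)
  have e : (fun y => affineField a c y i) = fun y => spRot a i - c * (Pi.single (tIdx n) 1 : Vc n) i
      + -a (tIdx n) * ContinuousLinearMap.proj (R := ℝ) (φ := fun _ : Fin (2 * n + 1) => ℝ) i y := by
    funext y
    simp [affineField]
    ring
  exact e ▸ h

lemma pd_contactHam_mul (a b : Vc n) (c d : ℝ) (x : Vc n) (i j : Fin (2 * n + 1)) :
    pd j (fun y => contactHam n (fun y => affineFn a c y * affineFn b d y) y i) x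
      = a j * affineField b d x i + b j * affineField a c x i
        - (affineFn a c x * b (tIdx n) + affineFn b d x * a (tIdx n))
          * (Pi.single j 1 : Vc n) i := by
  have h := ((hasFDerivAt_affineFn a c x).fun_mul (hasFDerivAt_affineField_apply b d x i)).fun_add
    ((hasFDerivAt_affineFn b d x).fun_mul (hasFDerivAt_affineField_apply a c x i))
  simp only [contactHam_mul, Pi.add_apply, Pi.smul_apply, smul_eq_mul]
  rw [pd, HasFDerivAt.fderiv h]
  simp
  ring

lemma pdB_eq {S : Vc n → Vc n → ℝ} {x ξ : Vc n}
    (hS : DifferentiableAt ℝ (fun z : Vc n × Vc n => S z.1 z.2) (x, ξ)) (i : Fin (2 * n + 1)) :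
    pdB n i S x ξ = fderiv ℝ (fun z : Vc n × Vc n => S z.1 z.2) (x, ξ) (Pi.single i 1, 0) := by
  have h : HasFDerivAt (fun y => S y ξ) _ x := HasFDerivAt.comp x (f := fun y => (y, ξ))
    hS.hasFDerivAt (hasFDerivAt_prodMk_left x ξ)
  rw [pdB, HasFDerivAt.fderiv h]
  simp

lemma pdF_eq {S : Vc n → Vc n → ℝ} {x ξ : Vc n}
    (hS : DifferentiableAt ℝ (fun z : Vc n × Vc n => S z.1 z.2) (x, ξ)) (i : Fin (2 * n + 1)) :
    pdF n i S x ξ = fderiv ℝ (fun z : Vc n × Vc n => S z.1 z.2) (x, ξ) (0, Pi.single i 1) := by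
  have h : HasFDerivAt (fun ζ => S x ζ) _ ξ := hS.hasFDerivAt.comp ξ (hasFDerivAt_prodMk_right x ξ)
  rw [pdF, HasFDerivAt.fderiv h]
  simp

lemma sum_mul_map_single {M : Type*} [AddCommGroup M] [Module ℝ M] (f : Vc n →ₗ[ℝ] M) (v : Vc n) :
    ∑ i, v i • f (Pi.single i 1) = f v := by
  conv_rhs => rw [← Finset.univ_sum_single v, map_sum]
  refine Finset.sum_congr rfl fun i _ => ?_
  rw [← map_smul, ← Pi.single_smul, smul_eq_mul, mul_one]

lemma sum_pdB_mul {S : Vc n → Vc n → ℝ} {x ξ : Vc n}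
    (hS : DifferentiableAt ℝ (fun z : Vc n × Vc n => S z.1 z.2) (x, ξ)) (v : Vc n) :
    ∑ i, v i * pdB n i S x ξ = fderiv ℝ (fun z : Vc n × Vc n => S z.1 z.2) (x, ξ) (v, 0) := by
  simp only [pdB_eq hS]
  exact sum_mul_map_single (((fderiv ℝ (fun z : Vc n × Vc n => S z.1 z.2) (x, ξ)).comp
    (ContinuousLinearMap.inl ℝ (Vc n) (Vc n))).toLinearMap) v

lemma sum_pdF_mul {S : Vc n → Vc n → ℝ} {x ξ : Vc n}
    (hS : DifferentiableAt ℝ (fun z : Vc n × Vc n => S z.1 z.2) (x, ξ)) (v : Vc n) :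
    ∑ i, v i * pdF n i S x ξ = fderiv ℝ (fun z : Vc n × Vc n => S z.1 z.2) (x, ξ) (0, v) := by
  simp only [pdF_eq hS]
  exact sum_mul_map_single (((fderiv ℝ (fun z : Vc n × Vc n => S z.1 z.2) (x, ξ)).comp
    (ContinuousLinearMap.inr ℝ (Vc n) (Vc n))).toLinearMap) v

/-- The cotangent lift (with the sign convention for contravariant symbols) of `X_{uv}`. -/
def genLift (a : Vc n) (c : ℝ) (b : Vc n) (d : ℝ) (z : Vc n × Vc n) : Vc n × Vc n :=
  (affineFn a c z.1 • affineField b d z.1 + affineFn b d z.1 • affineField a c z.1,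
    (affineFn a c z.1 * b (tIdx n) + affineFn b d z.1 * a (tIdx n)) • z.2
      - (affineField b d z.1 ⬝ᵥ z.2) • a - (affineField a c z.1 ⬝ᵥ z.2) • b)

/-- The derivative of `genLift` at `z` in the direction `w`. -/
def genLiftDeriv (a : Vc n) (c : ℝ) (b : Vc n) (d : ℝ) (z w : Vc n × Vc n) : Vc n × Vc n :=
  ((a ⬝ᵥ w.1) • affineField b d z.1 + (b ⬝ᵥ w.1) • affineField a c z.1
      - (affineFn a c z.1 * b (tIdx n) + affineFn b d z.1 * a (tIdx n)) • w.1,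
    ((a ⬝ᵥ w.1) * b (tIdx n) + (b ⬝ᵥ w.1) * a (tIdx n)) • z.2
      + (affineFn a c z.1 * b (tIdx n) + affineFn b d z.1 * a (tIdx n)) • w.2
      - (affineField b d z.1 ⬝ᵥ w.2 - b (tIdx n) * (w.1 ⬝ᵥ z.2)) • a
      - (affineField a c z.1 ⬝ᵥ w.2 - a (tIdx n) * (w.1 ⬝ᵥ z.2)) • b)

lemma Lgen_mul (k : ℕ) (δ : ℝ) (a b : Vc n) (c d : ℝ) {S : Vc n → Vc n → ℝ} {x ξ : Vc n}
    (hS : DifferentiableAt ℝ (fun z : Vc n × Vc n => S z.1 z.2) (x, ξ)) :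
    Lgen n k δ (fun y => affineFn a c y * affineFn b d y) S x ξ
      = fderiv ℝ (fun z : Vc n × Vc n => S z.1 z.2) (x, ξ) (genLift a c b d (x, ξ))
        - 2 * ((n + 1) * δ + k) * (affineFn a c x * b (tIdx n) + affineFn b d x * a (tIdx n))
          * S x ξ := by
  set ℓ := fderiv ℝ (fun z : Vc n × Vc n => S z.1 z.2) (x, ξ) with hℓ
  have h1 : ∀ v : Vc n, ∑ i, v i * pdB n i S x ξ = ℓ (v, 0) := fun v => sum_pdB_mul hS v
  have h2 : ∀ v : Vc n, ∑ i, v i * pdF n i S x ξ = ℓ (0, v) := fun v => sum_pdF_mul hS v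
  have hdiv : affineField b d x ⬝ᵥ a + affineField a c x ⬝ᵥ b
      = -(affineFn a c x * b (tIdx n) + affineFn b d x * a (tIdx n)) := by
    simp only [affineField, affineFn, sub_dotProduct, smul_dotProduct, single_one_dotProduct,
      smul_eq_mul, spRot_dotProduct_swap a b, dotProduct_comm x]
    ring
  have hsum : ∑ i, ∑ j, pd j (fun y => contactHam n
        (fun y => affineFn a c y * affineFn b d y) y i) x * ξ i * pdF n j S x ξ
      = (affineField b d x ⬝ᵥ ξ) * ℓ (0, a) + (affineField a c x ⬝ᵥ ξ) * ℓ (0, b)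
        - (affineFn a c x * b (tIdx n) + affineFn b d x * a (tIdx n)) * ℓ (0, ξ) := by
    have hin : ∀ j, ∑ i, pd j (fun y => contactHam n
          (fun y => affineFn a c y * affineFn b d y) y i) x * ξ i
        = a j * (affineField b d x ⬝ᵥ ξ) + b j * (affineField a c x ⬝ᵥ ξ)
          - (affineFn a c x * b (tIdx n) + affineFn b d x * a (tIdx n)) * ξ j := fun j => by
      simp only [pd_contactHam_mul, sub_mul, add_mul, Finset.sum_sub_distrib,
        Finset.sum_add_distrib, mul_assoc, ← Finset.mul_sum, dotProduct]
      simp [Pi.single_apply]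
    rw [Finset.sum_comm]
    simp only [← Finset.sum_mul, hin, ← h2, Finset.mul_sum]
    rw [← Finset.sum_add_distrib, ← Finset.sum_sub_distrib]
    exact Finset.sum_congr rfl fun j _ => by ring
  have hdivsum : ∑ i, pd i (fun y => contactHam n
        (fun y => affineFn a c y * affineFn b d y) y i) x
      = -(2 * n + 2) * (affineFn a c x * b (tIdx n) + affineFn b d x * a (tIdx n)) := by
    simp only [pd_contactHam_mul, Pi.single_eq_same, Finset.sum_sub_distrib,
      Finset.sum_add_distrib]
    have e1 : ∑ i, a i * affineField b d x i = affineField b d x ⬝ᵥ a := dotProduct_comm _ _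
    have e2 : ∑ i, b i * affineField a c x i = affineField a c x ⬝ᵥ b := dotProduct_comm _ _
    rw [e1, e2, hdiv]
    simp
    ring
  have hn : (n : ℝ) + 1 ≠ 0 := by positivity
  have hsplit : ∀ v w : Vc n, ℓ (v, w) = ℓ (v, 0) + ℓ (0, w) := fun v w => by
    rw [← map_add]; simp
  have h2' : ∀ (r : ℝ) (v : Vc n), ℓ (0, r • v) = r * ℓ (0, v) := fun r v => by
    have h := map_smul ℓ r (0, v)
    rwa [Prod.smul_mk, smul_zero] at h
  have h2s : ∀ v w : Vc n, ℓ (0, v - w) = ℓ (0, v) - ℓ (0, w) := fun v w => by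
    rw [← map_sub]; simp
  rw [Lgen, LAct, h1, hsum, hdivsum, contactHam_mul, genLift,
    hsplit _ (_ - _), h2s, h2s, h2', h2', h2']
  field_simp
  ring

lemma hasDerivAt_affineFn_line (a : Vc n) (c : ℝ) (x v : Vc n) :
    HasDerivAt (fun s : ℝ => affineFn a c (x + s • v)) (a ⬝ᵥ v) 0 := by
  have h := ((hasDerivAt_id (0 : ℝ)).mul_const (a ⬝ᵥ v)).const_add (affineFn a c x)
  rw [one_mul] at h
  have e : (fun s : ℝ => affineFn a c (x + s • v))
      = fun s => affineFn a c x + id s * a ⬝ᵥ v := by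
    funext s
    simp [affineFn, dotProduct_add, dotProduct_smul]
    ring
  exact e ▸ h

lemma hasDerivAt_line (x v : Vc n) : HasDerivAt (fun s : ℝ => x + s • v) v 0 := by
  simpa using ((hasDerivAt_id (0 : ℝ)).smul_const v).const_add x

lemma hasDerivAt_affineField_line (a : Vc n) (c : ℝ) (x v : Vc n) :
    HasDerivAt (fun s : ℝ => affineField a c (x + s • v)) (-a (tIdx n) • v) 0 := by
  have h := (((hasDerivAt_line x v).const_smul (a (tIdx n))).const_sub (spRot a)).sub_const
    (c • (Pi.single (tIdx n) 1 : Vc n))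
  rwa [← neg_smul] at h

lemma hasDerivAt_moment_line (a : Vc n) (c : ℝ) (x ξ v w : Vc n) :
    HasDerivAt (fun s : ℝ => affineField a c (x + s • v) ⬝ᵥ (ξ + s • w))
      (affineField a c x ⬝ᵥ w - a (tIdx n) * (v ⬝ᵥ ξ)) 0 := by
  have h1 := hasDerivAt_pi.1 (hasDerivAt_affineField_line a c x v)
  have h2 := hasDerivAt_pi.1 (hasDerivAt_line ξ w)
  have h := HasDerivAt.fun_sum (u := Finset.univ) fun i _ => (h1 i).fun_mul (h2 i)
  refine HasDerivAt.congr_deriv h ?_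
  simp [dotProduct, Finset.sum_add_distrib, Finset.mul_sum, mul_assoc]
  ring

lemma hasDerivAt_genLift_line (a b : Vc n) (c d : ℝ) (z w : Vc n × Vc n) :
    HasDerivAt (fun s : ℝ => genLift a c b d (z + s • w)) (genLiftDeriv a c b d z w) 0 := by
  have ha := hasDerivAt_affineFn_line a c z.1 w.1
  have hb := hasDerivAt_affineFn_line b d z.1 w.1
  have h := ((ha.smul (hasDerivAt_affineField_line b d z.1 w.1)).add
    (hb.smul (hasDerivAt_affineField_line a c z.1 w.1))).prodMk
    (((((ha.mul_const (b (tIdx n))).add (hb.mul_const (a (tIdx n)))).smul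
      (hasDerivAt_line z.2 w.2)).sub
      ((hasDerivAt_moment_line b d z.1 z.2 w.1 w.2).smul_const a)).sub
      ((hasDerivAt_moment_line a c z.1 z.2 w.1 w.2).smul_const b))
  refine HasDerivAt.congr_deriv
    (show HasDerivAt (fun s : ℝ => genLift a c b d (z + s • w)) _ 0 from h) ?_
  simp only [genLiftDeriv, zero_smul, add_zero, Prod.mk.injEq, Pi.add_apply]
  constructor <;> module

lemma contDiff_genLift (a b : Vc n) (c d : ℝ) : ContDiff ℝ (⊤ : ℕ∞) (genLift a c b d) := by
  unfold genLift affineField affineFn dotProduct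
  fun_prop

lemma fderiv_apply_eq_of_line {E : Type*} [NormedAddCommGroup E] [NormedSpace ℝ E]
    {G : E → ℝ} {z w : E} {g : ℝ} (hG : DifferentiableAt ℝ G z)
    (h : HasDerivAt (fun s : ℝ => G (z + s • w)) g 0) : fderiv ℝ G z w = g :=
  (hG.hasFDerivAt.hasLineDerivAt w).unique h

lemma Lgen_mul_comp (k : ℕ) (δ : ℝ) (a b a' b' : Vc n) (c d c' d' : ℝ) {S : Vc n → Vc n → ℝ}
    (hS : ContDiff ℝ (⊤ : ℕ∞) (fun z : Vc n × Vc n => S z.1 z.2)) (x ξ : Vc n) :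
    Lgen n k δ (fun y => affineFn a c y * affineFn b d y)
        (Lgen n k δ (fun y => affineFn a' c' y * affineFn b' d' y) S) x ξ
      = fderiv ℝ (fderiv ℝ (fun z : Vc n × Vc n => S z.1 z.2)) (x, ξ) (genLift a c b d (x, ξ))
          (genLift a' c' b' d' (x, ξ))
        + fderiv ℝ (fun z : Vc n × Vc n => S z.1 z.2) (x, ξ)
          (genLiftDeriv a' c' b' d' (x, ξ) (genLift a c b d (x, ξ))
            - (2 * ((n + 1) * δ + k)
              * (affineFn a' c' x * b' (tIdx n) + affineFn b' d' x * a' (tIdx n)))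
                • genLift a c b d (x, ξ)
            - (2 * ((n + 1) * δ + k)
              * (affineFn a c x * b (tIdx n) + affineFn b d x * a (tIdx n)))
                • genLift a' c' b' d' (x, ξ))
        + (-2 * ((n + 1) * δ + k)
            * ((a' ⬝ᵥ (genLift a c b d (x, ξ)).1) * b' (tIdx n)
              + (b' ⬝ᵥ (genLift a c b d (x, ξ)).1) * a' (tIdx n))
          + (2 * ((n + 1) * δ + k)
              * (affineFn a' c' x * b' (tIdx n) + affineFn b' d' x * a' (tIdx n)))
            * (2 * ((n + 1) * δ + k)
              * (affineFn a c x * b (tIdx n) + affineFn b d x * a (tIdx n)))) * S x ξ := by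
  set F : Vc n × Vc n → ℝ := fun z => S z.1 z.2 with hF
  set m : ℝ := 2 * ((n + 1) * δ + k) with hm
  have hF1 : Differentiable ℝ F := hS.differentiable (by simp)
  have hF2 : ContDiff ℝ (⊤ : ℕ∞) (fderiv ℝ F) := hS.fderiv_right (by simp)
  set G : Vc n × Vc n → ℝ := fun z => fderiv ℝ F z (genLift a' c' b' d' z)
    - m * (affineFn a' c' z.1 * b' (tIdx n) + affineFn b' d' z.1 * a' (tIdx n)) * F z with hG
  have hL : Lgen n k δ (fun y => affineFn a' c' y * affineFn b' d' y) S = fun x ξ => G (x, ξ) := by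
    funext x ξ
    exact Lgen_mul k δ a' b' c' d' (hF1 _)
  have haff : ∀ (a : Vc n) (c : ℝ), Differentiable ℝ fun z : Vc n × Vc n => affineFn a c z.1 :=
    fun a c z => (hasFDerivAt_affineFn a c z.1).differentiableAt.comp z differentiableAt_fst
  have hGd : Differentiable ℝ G := by
    have h1 := (hF2.clm_apply (contDiff_genLift a' b' c' d')).differentiable (by simp)
    have h2 := haff a' c'
    have h3 := haff b' d'
    fun_prop
  have hline : ∀ w : Vc n × Vc n, HasDerivAt (fun s : ℝ => (x, ξ) + s • w) w 0 := fun w => by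
    simpa using ((hasDerivAt_id (0 : ℝ)).smul_const w).const_add (x, ξ)
  have hzero : ∀ w : Vc n × Vc n, (x, ξ) + (0 : ℝ) • w = (x, ξ) := by simp
  have hFl : ∀ w, HasDerivAt (fun s : ℝ => F ((x, ξ) + s • w)) (fderiv ℝ F (x, ξ) w) 0 :=
    fun w => HasFDerivAt.comp_hasDerivAt (l := F) (0 : ℝ)
      (by rw [hzero]; exact (hF1 _).hasFDerivAt) (hline w)
  have hF2l : ∀ w, HasDerivAt (fun s : ℝ => fderiv ℝ F ((x, ξ) + s • w))
      (fderiv ℝ (fderiv ℝ F) (x, ξ) w) 0 :=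
    fun w => HasFDerivAt.comp_hasDerivAt (0 : ℝ)
      (by rw [hzero]; exact (hF2.differentiable (by simp) _).hasFDerivAt) (hline w)
  have hGl : ∀ w, fderiv ℝ G (x, ξ) w = _ := fun w => fderiv_apply_eq_of_line (hGd _)
    (((hF2l w).clm_apply (hasDerivAt_genLift_line a' b' c' d' (x, ξ) w)).sub
      (((((hasDerivAt_affineFn_line a' c' x w.1).mul_const (b' (tIdx n))).add
        ((hasDerivAt_affineFn_line b' d' x w.1).mul_const (a' (tIdx n)))).const_mul m).mul
        (hFl w)))
  rw [hL, Lgen_mul k δ a b c d (hGd _)]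
  change fderiv ℝ G (x, ξ) _ - _ * G (x, ξ) = _
  rw [hGl]
  simp only [hG, zero_smul, add_zero, Pi.add_apply, map_sub, map_smul, smul_eq_mul]
  ring

lemma spRot_add (a b : Vc n) : spRot (a + b) = spRot a + spRot b := by
  funext e
  induction e using index_cases <;> simp [add_comm]

lemma spRot_smul (r : ℝ) (a : Vc n) : spRot (r • a) = r • spRot a := by
  funext e
  induction e using index_cases <;> simp

lemma spRot_single_tIdx : spRot (Pi.single (tIdx n) 1 : Vc n) = 0 := by
  funext e
  induction e using index_cases <;> simp [pIdx_ne_tIdx, qIdx_ne_tIdx]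

lemma spRot_neg (a : Vc n) : spRot (-a) = -spRot a := by
  simpa using spRot_smul (-1) a

lemma spRot_sub (a b : Vc n) : spRot (a - b) = spRot a - spRot b := by
  rw [sub_eq_add_neg, spRot_add, spRot_neg, sub_eq_add_neg]

lemma spRot_spRot (a : Vc n) : spRot (spRot a) = a (tIdx n) • Pi.single (tIdx n) 1 - a := by
  funext e
  induction e using index_cases <;> simp [pIdx_ne_tIdx, qIdx_ne_tIdx]

lemma spRot_dotProduct_self (a : Vc n) : spRot a ⬝ᵥ a = 0 := by
  have := spRot_dotProduct_swap a a
  linarith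

/-- The base component of the vector field of the first-order operator `genHam`. -/
def genHamField (x ξ : Vc n) : Vc n :=
  -spRot ξ + ξ (tIdx n) • x - (x ⬝ᵥ ξ) • Pi.single (tIdx n) 1

lemma genHam_eq {S : Vc n → Vc n → ℝ} {x ξ : Vc n} (r : ℝ)
    (hS : DifferentiableAt ℝ (fun z : Vc n × Vc n => S z.1 z.2) (x, ξ)) :
    genHam n r S x ξ = fderiv ℝ (fun z : Vc n × Vc n => S z.1 z.2) (x, ξ) (genHamField x ξ, 0)
      + r * ξ (tIdx n) * S x ξ := by
  rw [genHam, ← sum_pdB_mul hS, sum_index]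
  simp only [genHamField, Pi.sub_apply, Pi.add_apply, Pi.neg_apply, Pi.smul_apply, spRot_pIdx,
    spRot_qIdx, spRot_tIdx, smul_eq_mul, neg_neg, neg_zero, zero_add, ne_eq, pIdx_ne_tIdx,
    qIdx_ne_tIdx, not_false_eq_true, Pi.single_eq_of_ne, Pi.single_eq_same, mul_zero, sub_zero,
    mul_one, Finset.mul_sum]
  rw [← Finset.sum_add_distrib, dotProduct, sum_index]
  have e : ∀ i, ξ (qIdx n i) * pdB n (pIdx n i) S x ξ - ξ (pIdx n i) * pdB n (qIdx n i) S x ξ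
      + ξ (tIdx n) * (x (pIdx n i) * pdB n (pIdx n i) S x ξ
        + x (qIdx n i) * pdB n (qIdx n i) S x ξ)
      = (ξ (qIdx n i) + ξ (tIdx n) * x (pIdx n i)) * pdB n (pIdx n i) S x ξ
        + (-ξ (pIdx n i) + ξ (tIdx n) * x (qIdx n i)) * pdB n (qIdx n i) S x ξ := fun i => by ring
  rw [Finset.sum_congr rfl fun i _ => e i]
  ring

/-- The vector field of the derivation `iAlpha`. -/
def iAlphaField (x : Vc n) : Vc n := (1 / 2 : ℝ) • (spRot x - Pi.single (tIdx n) 1)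

lemma iAlpha_eq {S : Vc n → Vc n → ℝ} {x ξ : Vc n}
    (hS : DifferentiableAt ℝ (fun z : Vc n × Vc n => S z.1 z.2) (x, ξ)) :
    iAlpha n S x ξ
      = fderiv ℝ (fun z : Vc n × Vc n => S z.1 z.2) (x, ξ) (0, iAlphaField x) := by
  rw [iAlpha, ← sum_pdF_mul hS, sum_index]
  simp only [iAlphaField, Pi.sub_apply, Pi.smul_apply, spRot_pIdx,
    spRot_qIdx, spRot_tIdx, smul_eq_mul, ne_eq, pIdx_ne_tIdx,
    qIdx_ne_tIdx, not_false_eq_true, Pi.single_eq_of_ne, Pi.single_eq_same, sub_zero]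
  rw [mul_sub, Finset.mul_sum]
  have e : ∀ i, 1 / 2 * (x (pIdx n i) * pdF n (qIdx n i) S x ξ
        - x (qIdx n i) * pdF n (pIdx n i) S x ξ)
      = 1 / 2 * -x (qIdx n i) * pdF n (pIdx n i) S x ξ
        + 1 / 2 * x (pIdx n i) * pdF n (qIdx n i) S x ξ := fun i => by ring
  rw [Finset.sum_congr rfl fun i _ => e i]
  ring

lemma genHam_iAlpha {S : Vc n → Vc n → ℝ} (r : ℝ)
    (hS : ContDiff ℝ (⊤ : ℕ∞) (fun z : Vc n × Vc n => S z.1 z.2)) (x ξ : Vc n) :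
    genHam n r (iAlpha n S) x ξ
      = fderiv ℝ (fderiv ℝ (fun z : Vc n × Vc n => S z.1 z.2)) (x, ξ) (genHamField x ξ, 0)
          (0, iAlphaField x)
        + fderiv ℝ (fun z : Vc n × Vc n => S z.1 z.2) (x, ξ)
          (0, (1 / 2 : ℝ) • spRot (genHamField x ξ) + (r * ξ (tIdx n)) • iAlphaField x) := by
  set F : Vc n × Vc n → ℝ := fun z => S z.1 z.2 with hF
  have hF1 : Differentiable ℝ F := hS.differentiable (by simp)
  have hF2 : Differentiable ℝ (fderiv ℝ F) :=
    (hS.fderiv_right (m := (⊤ : ℕ∞)) (by simp)).differentiable (by simp)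
  set w : Vc n × Vc n := (genHamField x ξ, 0) with hw
  have hα : iAlpha n S = fun x ξ => fderiv ℝ F (x, ξ) (0, iAlphaField x) := by
    funext x ξ
    exact iAlpha_eq (hF1 _)
  have hfield : Differentiable ℝ fun z : Vc n × Vc n => ((0 : Vc n), iAlphaField z.1) := by
    have h : Differentiable ℝ (spRot : Vc n → Vc n) :=
      (LinearMap.toContinuousLinearMap
        (⟨⟨spRot, spRot_add⟩, spRot_smul⟩ : Vc n →ₗ[ℝ] Vc n)).differentiable
    unfold iAlphaField
    fun_prop
  have hG : DifferentiableAt ℝ (fun z : Vc n × Vc n => iAlpha n S z.1 z.2) (x, ξ) := by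
    rw [hα]
    exact (hF2.clm_apply hfield) _
  rw [genHam_eq r hG]
  have hline : HasDerivAt (fun s : ℝ => (x, ξ) + s • w) w 0 := by
    simpa using ((hasDerivAt_id (0 : ℝ)).smul_const w).const_add (x, ξ)
  have hl2 : HasDerivAt (fun s : ℝ => fderiv ℝ F ((x, ξ) + s • w))
      (fderiv ℝ (fderiv ℝ F) (x, ξ) w) 0 :=
    HasFDerivAt.comp_hasDerivAt (0 : ℝ) (by simpa using (hF2 (x, ξ)).hasFDerivAt) hline
  have hlα : HasDerivAt (fun s : ℝ => ((0 : Vc n), iAlphaField (x + s • w.1)))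
      (0, (1 / 2 : ℝ) • spRot w.1) 0 := by
    have e : (fun s : ℝ => iAlphaField (x + s • w.1))
        = fun s => iAlphaField x + id s • ((1 / 2 : ℝ) • spRot w.1) := by
      funext s
      simp only [iAlphaField, spRot_add, spRot_smul, id]
      module
    refine (hasDerivAt_const (0 : ℝ) (0 : Vc n)).prodMk (e ▸ ?_)
    simpa using ((hasDerivAt_id (0 : ℝ)).smul_const ((1 / 2 : ℝ) • spRot w.1)).const_add
      (iAlphaField x)
  have hG' : fderiv ℝ (fun z : Vc n × Vc n => iAlpha n S z.1 z.2) (x, ξ) w = _ :=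
    fderiv_apply_eq_of_line hG (by rw [hα]; exact hl2.clm_apply hlα)
  have hsplit : ((0 : Vc n), (1 / 2 : ℝ) • spRot (genHamField x ξ)
        + (r * ξ (tIdx n)) • iAlphaField x)
      = (0, (1 / 2 : ℝ) • spRot (genHamField x ξ)) + (r * ξ (tIdx n)) • (0, iAlphaField x) := by
    simp
  rw [hG', hα, hsplit, map_add, map_smul]
  simp only [hw, zero_smul, add_zero, smul_eq_mul]
  ring

lemma euler_fst {k : ℕ} {S : Vc n → Vc n → ℝ} (hS : InR n k S) (z : Vc n × Vc n) :
    fderiv ℝ (fun z : Vc n × Vc n => S z.1 z.2) z (0, z.2) = k * S z.1 z.2 := by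
  refine fderiv_apply_eq_of_line (hS.1.differentiable (by simp) z) ?_
  have e : (fun s : ℝ => S (z + s • ((0 : Vc n), z.2)).1 (z + s • ((0 : Vc n), z.2)).2)
      = fun s => (1 + s) ^ k * S z.1 z.2 := by
    funext s
    rw [← hS.2, add_smul, one_smul]
    simp
  have h := (((hasDerivAt_id (0 : ℝ)).const_add 1).pow k).mul_const (S z.1 z.2)
  rw [e]
  simpa using h

lemma euler_snd {k : ℕ} {S : Vc n → Vc n → ℝ} (hS : InR n k S) (z v : Vc n × Vc n) :
    fderiv ℝ (fderiv ℝ (fun z : Vc n × Vc n => S z.1 z.2)) z v (0, z.2)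
      = k * fderiv ℝ (fun z : Vc n × Vc n => S z.1 z.2) z v
        - fderiv ℝ (fun z : Vc n × Vc n => S z.1 z.2) z (0, v.2) := by
  have hF2 : Differentiable ℝ (fderiv ℝ (fun z : Vc n × Vc n => S z.1 z.2)) :=
    (hS.1.fderiv_right (m := (⊤ : ℕ∞)) (by simp)).differentiable (by simp)
  have h1 := (hF2 z).hasFDerivAt.clm_apply
    ((hasFDerivAt_const (0 : Vc n) z).prodMk (hasFDerivAt_snd (𝕜 := ℝ) (p := z)))
  simp only [euler_fst hS] at h1
  have h2 := ((hS.1.differentiable (by simp) z).hasFDerivAt.const_mul (k : ℝ))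
  have h := DFunLike.congr_fun (h1.unique h2) v
  simp at h
  linarith

lemma sndDeriv_symm {S : Vc n → Vc n → ℝ}
    (hS : ContDiff ℝ (⊤ : ℕ∞) (fun z : Vc n × Vc n => S z.1 z.2)) (z v w : Vc n × Vc n) :
    fderiv ℝ (fderiv ℝ (fun z : Vc n × Vc n => S z.1 z.2)) z v w
      = fderiv ℝ (fderiv ℝ (fun z : Vc n × Vc n => S z.1 z.2)) z w v :=
  (hS.contDiffAt.isSymmSndFDerivAt (by
    rw [minSmoothness_of_isRCLikeNormedField]
    exact WithTop.coe_le_coe.2 le_top)).eq v w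

end Calculus

section Contraction
variable {n : ℕ}

/-- The affine functions `p_i` (`(true, some i)`), `t` (`(true, none)`), `q^i` (`(false, some i)`)
and `1` (`(false, none)`), as pairs (gradient, constant term). -/
def affBasis : Bool × Option (Fin n) → Vc n × ℝ
  | (true, some i) => (Pi.single (pIdx n i) 1, 0)
  | (true, none) => (Pi.single (tIdx n) 1, 0)
  | (false, some i) => (Pi.single (qIdx n i) 1, 0)
  | (false, none) => (0, 1)

/-- The symplectically dual basis vector, with its sign. -/
def affDual (a : Bool × Option (Fin n)) : Vc n × ℝ :=
  (if a.1 then -1 else 1 : ℝ) • affBasis (!a.1, a.2)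

lemma affDual_true (o : Option (Fin n)) : affDual (true, o) = -affBasis (false, o) := by
  simp [affDual]

lemma affDual_false (o : Option (Fin n)) : affDual (false, o) = affBasis (true, o) := by
  simp [affDual]

lemma sum_basis {M : Type*} [AddCommMonoid M] (f : Bool × Option (Fin n) → M) :
    ∑ a, f a = f (true, none) + ∑ i, f (true, some i)
      + (f (false, none) + ∑ i, f (false, some i)) := by
  rw [Fintype.sum_prod_type, Fintype.sum_bool, Fintype.sum_option, Fintype.sum_option]

/-- The linear form `(a, c) ↦ v ⬝ᵥ a + r c`. -/
def affForm (v : Vc n) (r : ℝ) : Vc n × ℝ →ₗ[ℝ] ℝ :=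
  (dotProductBilin ℝ ℝ v).coprod (r • LinearMap.id)

@[simp] lemma affForm_apply (v : Vc n) (r : ℝ) (e : Vc n × ℝ) :
    affForm v r e = v ⬝ᵥ e.1 + r * e.2 := rfl

/-- The contraction of a linear form with the symplectic structure. -/
def affRot (v : Vc n) (r : ℝ) : Vc n × ℝ := (-spRot v + r • Pi.single (tIdx n) 1, -v (tIdx n))

lemma sum_affForm_smul_affDual (v : Vc n) (r : ℝ) :
    ∑ a, affForm v r (affBasis a) • affDual a = affRot v r := by
  rw [sum_basis]
  simp only [affDual, affBasis, affForm_apply, affRot]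
  refine Prod.ext ?_ ?_
  · funext e
    simp only [Prod.fst_add, Prod.fst_sum, Pi.add_apply, Finset.sum_apply]
    induction e using index_cases with
    | hp j => simp [Pi.single_apply, pIdx_inj, pIdx_ne_qIdx, pIdx_ne_tIdx]
    | hq j => simp [Pi.single_apply, qIdx_inj, (pIdx_ne_qIdx _ _).symm, qIdx_ne_tIdx]
    | ht => simp [(pIdx_ne_tIdx _).symm, (qIdx_ne_tIdx _).symm]
  · simp [Prod.snd_sum]

lemma sum_affForm_affDual_smul (v : Vc n) (r : ℝ) :
    ∑ a, affForm v r (affDual a) • affBasis a = -affRot v r := by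
  rw [← sum_affForm_smul_affDual, sum_basis, sum_basis]
  simp only [affDual_true, affDual_false, map_neg, smul_neg, neg_smul, Finset.sum_neg_distrib]
  abel

lemma sum_affForm_mul_affDual (v : Vc n) (r : ℝ) (Ψ : Vc n × ℝ →ₗ[ℝ] ℝ) :
    ∑ a, affForm v r (affBasis a) * Ψ (affDual a) = Ψ (affRot v r) := by
  simp only [← sum_affForm_smul_affDual, map_sum, map_smul, smul_eq_mul]

lemma sum_affForm_affDual_mul (v : Vc n) (r : ℝ) (Ψ : Vc n × ℝ →ₗ[ℝ] ℝ) :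
    ∑ a, affForm v r (affDual a) * Ψ (affBasis a) = -Ψ (affRot v r) := by
  rw [← map_neg, ← sum_affForm_affDual_smul]
  simp only [map_sum, map_smul, smul_eq_mul]

lemma sum_affField_affBasis (x : Vc n) :
    ∑ a : Bool × Option (Fin n),
      affineField (affBasis a).1 (affBasis a).2 x ⬝ᵥ (affDual a).1 = -(2 * n + 1) := by
  rw [sum_basis]
  simp [affDual, affBasis, affineField, (pIdx_ne_tIdx _).symm, (qIdx_ne_tIdx _).symm]
  ring

lemma sum_affField_affDual (x : Vc n) :
    ∑ a : Bool × Option (Fin n),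
      affineField (affDual a).1 (affDual a).2 x ⬝ᵥ (affBasis a).1 = 2 * n + 1 := by
  rw [sum_basis]
  simp [affDual, affBasis, affineField, (pIdx_ne_tIdx _).symm, (qIdx_ne_tIdx _).symm]
  ring

/-- The cotangent lift of the vector field of an affine function, as a linear map. -/
def liftH (x ξ : Vc n) : Vc n × ℝ →ₗ[ℝ] Vc n × Vc n where
  toFun e := (affineField e.1 e.2 x, e.1 (tIdx n) • ξ)
  map_add' e e' := by
    refine Prod.ext ?_ ?_
    · simp only [affineField, Prod.fst_add, Prod.snd_add, spRot_add, Pi.add_apply]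
      module
    · simp [add_smul]
  map_smul' r e := by
    refine Prod.ext ?_ ?_
    · simp only [affineField, Prod.smul_fst, Prod.smul_snd, spRot_smul, Pi.smul_apply,
        smul_eq_mul, RingHom.id_apply]
      module
    · simp [mul_smul]

/-- The vertical lift of the differential of an affine function. -/
def liftD (n : ℕ) : Vc n × ℝ →ₗ[ℝ] Vc n × Vc n :=
  LinearMap.inr ℝ (Vc n) (Vc n) ∘ₗ LinearMap.fst ℝ (Vc n) ℝ

/-- The value at `x` of an affine function. -/
def formU (x : Vc n) : Vc n × ℝ →ₗ[ℝ] ℝ := affForm x 1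

/-- The derivative of an affine function along the `t`-direction. -/
def formT (n : ℕ) : Vc n × ℝ →ₗ[ℝ] ℝ := affForm (Pi.single (tIdx n) 1) 0

/-- The derivative in direction `w` of the moment `affineField a c x ⬝ᵥ ξ`. -/
def formDM (x ξ : Vc n) (w : Vc n × Vc n) : Vc n × ℝ →ₗ[ℝ] ℝ :=
  affForm (-spRot w.2 - (x ⬝ᵥ w.2 + w.1 ⬝ᵥ ξ) • Pi.single (tIdx n) 1) (-w.2 (tIdx n))

/-- The moment `affineField a c x ⬝ᵥ ξ`. -/
def formM (x ξ : Vc n) : Vc n × ℝ →ₗ[ℝ] ℝ :=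
  affForm (-spRot ξ - (x ⬝ᵥ ξ) • Pi.single (tIdx n) 1) (-ξ (tIdx n))

lemma affineFn_eq_formU (e : Vc n × ℝ) (x : Vc n) : affineFn e.1 e.2 x = formU x e := by
  simp [affineFn, formU, dotProduct_comm]

lemma formT_apply (e : Vc n × ℝ) : formT n e = e.1 (tIdx n) := by simp [formT]

lemma affineField_dotProduct (e : Vc n × ℝ) (x ξ : Vc n) :
    affineField e.1 e.2 x ⬝ᵥ ξ = formM x ξ e := by
  simp [affineField, formM, sub_dotProduct, spRot_dotProduct_swap e.1]
  ring

lemma formDM_apply (e : Vc n × ℝ) (x ξ : Vc n) (w : Vc n × Vc n) :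
    formDM x ξ w e = affineField e.1 e.2 x ⬝ᵥ w.2 - e.1 (tIdx n) * (w.1 ⬝ᵥ ξ) := by
  simp [affineField, formDM, sub_dotProduct, spRot_dotProduct_swap e.1]
  ring

lemma genLift_eq (a b : Vc n × ℝ) (x ξ : Vc n) :
    genLift a.1 a.2 b.1 b.2 (x, ξ) = formU x a • liftH x ξ b + formU x b • liftH x ξ a
      - formM x ξ b • liftD n a - formM x ξ a • liftD n b := by
  simp only [genLift, affineFn_eq_formU, affineField_dotProduct]
  refine Prod.ext ?_ ?_
  · simp [liftH, liftD]
  · simp [liftH, liftD]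
    module

lemma genLiftDeriv_eq (a b : Vc n × ℝ) (x ξ : Vc n) (w : Vc n × Vc n) :
    genLiftDeriv a.1 a.2 b.1 b.2 (x, ξ) w
      = affForm w.1 0 a • liftH x ξ b + affForm w.1 0 b • liftH x ξ a
        + (formU x a * formT n b + formU x b * formT n a) • (-w.1, w.2)
        - formDM x ξ w b • liftD n a - formDM x ξ w a • liftD n b := by
  simp only [genLiftDeriv, affineFn_eq_formU, formDM_apply, formT_apply]
  refine Prod.ext ?_ ?_
  · simp [liftH, liftD, dotProduct_comm w.1]
    module
  · simp [liftH, liftD, dotProduct_comm w.1]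
    module

section Values
variable (x ξ : Vc n)

/-- The contraction of `formU`. -/
def rotU (x : Vc n) : Vc n × ℝ := affRot x 1

/-- The contraction of `formM`. -/
def rotM (x ξ : Vc n) : Vc n × ℝ :=
  affRot (-spRot ξ - (x ⬝ᵥ ξ) • Pi.single (tIdx n) 1) (-ξ (tIdx n))

lemma rotU_eq : rotU x = (-spRot x + Pi.single (tIdx n) 1, -x (tIdx n)) := by
  simp [rotU, affRot]

lemma rotM_eq : rotM x ξ = (-ξ, x ⬝ᵥ ξ) := by
  simp [rotM, affRot, spRot_sub, spRot_neg, spRot_smul, spRot_single_tIdx, spRot_spRot]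
  abel

lemma formU_rotU : formU x (rotU x) = 0 := by
  simp [rotU_eq, formU, dotProduct_comm x, spRot_dotProduct_self]

lemma formM_rotU : formM x ξ (rotU x) = 0 := by
  simp [rotU_eq, formM, sub_dotProduct, dotProduct_add, spRot_dotProduct_swap ξ, spRot_spRot]
  ring

lemma formT_rotU : formT n (rotU x) = 1 := by
  simp [rotU_eq, formT_apply]

lemma formU_rotM : formU x (rotM x ξ) = 0 := by
  simp [rotM_eq, formU]

lemma formM_rotM : formM x ξ (rotM x ξ) = 0 := by
  simp [rotM_eq, formM, sub_dotProduct, spRot_dotProduct_self]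
  ring

lemma formT_rotM : formT n (rotM x ξ) = -ξ (tIdx n) := by
  simp [rotM_eq, formT_apply]

lemma liftH_rotU : liftH x ξ (rotU x) = (0, ξ) := by
  simp [liftH, rotU_eq, affineField, spRot_add, spRot_neg, spRot_single_tIdx, spRot_spRot]

lemma liftD_rotU : liftD n (rotU x) = (-2 : ℝ) • (0, iAlphaField x) := by
  simp [liftD, rotU_eq, iAlphaField]
  module

lemma liftH_rotM : liftH x ξ (rotM x ξ) = (genHamField x ξ, -ξ (tIdx n) • ξ) := by
  simp [liftH, rotM_eq, affineField, spRot_neg, genHamField]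

lemma liftD_rotM : liftD n (rotM x ξ) = -(0, ξ) := by
  simp [liftD, rotM_eq]

lemma affForm_liftH_rotU (b : Vc n × ℝ) :
    affForm (liftH x ξ b).1 0 (rotU x) = -formU x b := by
  have h : x ⬝ᵥ spRot x = 0 := by rw [dotProduct_comm, spRot_dotProduct_self]
  simp [liftH, rotU_eq, affineField, formU, sub_dotProduct, dotProduct_add,
    spRot_dotProduct_swap b.1, spRot_spRot, h]
  ring

lemma formDM_liftH (b d : Vc n × ℝ) :
    formDM x ξ (liftH x ξ b) d = formT n b * formM x ξ d - formT n d * formM x ξ b := by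
  rw [formDM_apply, ← affineField_dotProduct, ← affineField_dotProduct, formT_apply, formT_apply]
  simp [liftH]

lemma formDM_liftD (b d : Vc n × ℝ) :
    formDM x ξ (liftD n b) d = affineField d.1 d.2 x ⬝ᵥ b.1 := by
  simp [formDM_apply, liftD]

lemma formDM_liftH_rotU (b : Vc n × ℝ) :
    formDM x ξ (liftH x ξ b) (rotU x) = -formM x ξ b := by
  simp [formDM_liftH, formM_rotU, formT_rotU]

lemma formDM_liftD_rotM (b : Vc n × ℝ) :
    formDM x ξ (liftD n b) (rotM x ξ) = formM x ξ b + ξ (tIdx n) * formU x b := by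
  have h : affineField (rotM x ξ).1 (rotM x ξ).2 x = genHamField x ξ :=
    congrArg Prod.fst (liftH_rotM x ξ)
  rw [formDM_liftD, h]
  simp [genHamField, formM, formU, sub_dotProduct]
  ring

end Values

end Contraction

section Kernel
variable {n : ℕ}

/-- The lift `genLift` of the product of two affine functions. -/
def symLift (x ξ : Vc n) (c d : Vc n × ℝ) : Vc n × Vc n :=
  formU x c • liftH x ξ d + formU x d • liftH x ξ c
    - formM x ξ d • liftD n c - formM x ξ c • liftD n d

/-- The derivative of `symLift` in the direction `w`. -/
def symLiftDeriv (x ξ : Vc n) (c d : Vc n × ℝ) (w : Vc n × Vc n) : Vc n × Vc n :=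
  affForm w.1 0 c • liftH x ξ d + affForm w.1 0 d • liftH x ξ c
    + (formU x c * formT n d + formU x d * formT n c) • (-w.1, w.2)
    - formDM x ξ w d • liftD n c - formDM x ξ w c • liftD n d

/-- The derivative along `t` of the product of two affine functions. -/
def symT (x : Vc n) (c d : Vc n × ℝ) : ℝ := formU x c * formT n d + formU x d * formT n c

/-- The composite of a first-order operator with symbol `(w, -m r)` and the action of the
product of the affine functions `c` and `d`, applied to a function with value `f`, differential
`ℓ` and second differential `B`. -/
def casKer (B : Vc n × Vc n →ₗ[ℝ] Vc n × Vc n →ₗ[ℝ] ℝ) (ℓ : Vc n × Vc n →ₗ[ℝ] ℝ) (m f : ℝ)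
    (x ξ : Vc n) (w : Vc n × Vc n) (r : ℝ) (c d : Vc n × ℝ) : ℝ :=
  B w (symLift x ξ c d) + ℓ (symLiftDeriv x ξ c d w) - m * symT x c d * ℓ w
    - m * r * ℓ (symLift x ξ c d)
    + (-m * (affForm w.1 0 c * formT n d + affForm w.1 0 d * formT n c)
      + m ^ 2 * symT x c d * r) * f

variable (B : Vc n × Vc n →ₗ[ℝ] Vc n × Vc n →ₗ[ℝ] ℝ) (ℓ : Vc n × Vc n →ₗ[ℝ] ℝ) (m f : ℝ)
  (x ξ : Vc n)

lemma symLift_comm (c d : Vc n × ℝ) : symLift x ξ c d = symLift x ξ d c := by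
  simp only [symLift]; abel

lemma symT_comm (c d : Vc n × ℝ) : symT x c d = symT x d c := by
  simp only [symT]; ring

lemma casKer_comm (w : Vc n × Vc n) (r : ℝ) (c d : Vc n × ℝ) :
    casKer B ℓ m f x ξ w r c d = casKer B ℓ m f x ξ w r d c := by
  have h : symLiftDeriv x ξ c d w = symLiftDeriv x ξ d c w := by
    simp only [symLiftDeriv, add_comm (formU x c * _)]; abel
  simp only [casKer, h, symLift_comm x ξ c d, symT_comm x c d]
  ring

/-- `casKer` is linear in the first of the two affine functions. -/
def casKerLin (w : Vc n × Vc n) (r : ℝ) (d : Vc n × ℝ) : Vc n × ℝ →ₗ[ℝ] ℝ where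
  toFun c := casKer B ℓ m f x ξ w r c d
  map_add' c c' := by
    simp only [casKer, symLift, symLiftDeriv, symT, map_add, map_sub, map_smul, smul_eq_mul]
    ring
  map_smul' s c := by
    simp only [casKer, symLift, symLiftDeriv, symT, map_add, map_sub, map_smul, smul_eq_mul,
      RingHom.id_apply]
    ring

lemma casKer_combo (w w' : Vc n × Vc n) (r r' s s' : ℝ) (c d : Vc n × ℝ) :
    casKer B ℓ m f x ξ (s • w + s' • w') (s * r + s' * r') c d
      = s * casKer B ℓ m f x ξ w r c d + s' * casKer B ℓ m f x ξ w' r' c d := by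
  have h1 : ∀ e : Vc n × ℝ, affForm (s • w + s' • w').1 0 e
      = s * affForm w.1 0 e + s' * affForm w'.1 0 e := fun e => by
    simp [add_dotProduct]
  have h2 : ∀ e : Vc n × ℝ, formDM x ξ (s • w + s' • w') e
      = s * formDM x ξ w e + s' * formDM x ξ w' e := fun e => by
    simp only [formDM_apply, Prod.fst_add, Prod.snd_add, Prod.smul_fst, Prod.smul_snd,
      dotProduct_add, add_dotProduct, dotProduct_smul, smul_dotProduct, smul_eq_mul]
    ring
  have h3 : ((-(s • w + s' • w').1, (s • w + s' • w').2) : Vc n × Vc n)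
      = s • (-w.1, w.2) + s' • (-w'.1, w'.2) := by
    refine Prod.ext ?_ ?_
    · simp; abel
    · simp
  simp only [casKer, symLift, symLiftDeriv, symT, h1, h2, h3, map_add, map_sub, map_smul,
    smul_eq_mul, LinearMap.add_apply, LinearMap.smul_apply]
  ring

lemma casKer_symLift (a b c d : Vc n × ℝ) :
    casKer B ℓ m f x ξ (symLift x ξ a b) (symT x a b) c d
      = (formU x a * casKer B ℓ m f x ξ (liftH x ξ b) (formT n b) c d
          - formM x ξ a * casKer B ℓ m f x ξ (liftD n b) 0 c d)
        + (formU x b * casKer B ℓ m f x ξ (liftH x ξ a) (formT n a) c d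
          - formM x ξ b * casKer B ℓ m f x ξ (liftD n a) 0 c d) := by
  have h1 : symLift x ξ a b
      = (1 : ℝ) • (formU x a • liftH x ξ b + -formM x ξ a • liftD n b)
        + (1 : ℝ) • (formU x b • liftH x ξ a + -formM x ξ b • liftD n a) := by
    simp only [symLift]; module
  have h2 : symT x a b = 1 * (formU x a * formT n b + -formM x ξ a * 0)
      + 1 * (formU x b * formT n a + -formM x ξ b * 0) := by
    simp only [symT]; ring
  rw [h1, h2]
  simp only [casKer_combo]
  ring

lemma casKer_rotU (b d : Vc n × ℝ) :
    casKer B ℓ m f x ξ (liftH x ξ b) (formT n b) (rotU x) d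
      = B (liftH x ξ b) (formU x d • (0, ξ) - formM x ξ d • liftD n (rotU x))
        + ℓ (-formU x b • liftH x ξ d + (affineField b.1 b.2 x ⬝ᵥ d.1) • (0, ξ)
          + formU x d • (-(liftH x ξ b).1, (liftH x ξ b).2)
          - (formT n b * formM x ξ d - formT n d * formM x ξ b) • liftD n (rotU x)
          + formM x ξ b • liftD n d)
        - m * formU x d * ℓ (liftH x ξ b)
        - m * formT n b * ℓ (formU x d • (0, ξ) - formM x ξ d • liftD n (rotU x))
        + (-m * (-formU x b * formT n d + affineField b.1 b.2 x ⬝ᵥ d.1)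
          + m ^ 2 * formU x d * formT n b) * f := by
  have h : affForm (liftH x ξ b).1 0 d = affineField b.1 b.2 x ⬝ᵥ d.1 := by simp [liftH]
  simp only [casKer, symLift, symLiftDeriv, symT, affForm_liftH_rotU, formU_rotU, formM_rotU,
    formT_rotU, formDM_liftH_rotU, formDM_liftH x ξ b d, liftH_rotU, h, zero_smul, zero_add, sub_zero,
    zero_mul, mul_one, neg_smul, sub_neg_eq_add]

lemma casKer_rotM (b d : Vc n × ℝ) :
    casKer B ℓ m f x ξ (liftD n b) 0 (rotM x ξ) d
      = B (liftD n b) (formU x d • liftH x ξ (rotM x ξ) + formM x ξ d • (0, ξ))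
        + ℓ (-(ξ (tIdx n) * formU x d) • liftD n b + (affineField d.1 d.2 x ⬝ᵥ b.1) • (0, ξ)
          - (formM x ξ b + ξ (tIdx n) * formU x b) • liftD n d)
        + m * ξ (tIdx n) * formU x d * ℓ (liftD n b) := by
  have h : ∀ e, affForm (liftD n b).1 0 e = 0 := by simp [liftD]
  have h' : (-(liftD n b).1, (liftD n b).2) = liftD n b := by simp [liftD]
  simp only [casKer, symLift, symLiftDeriv, symT, formU_rotM, formM_rotM, formT_rotM,
    formDM_liftD_rotM, formDM_liftD x ξ b d, liftD_rotM, h, h', zero_smul, zero_add, sub_zero, zero_mul,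
    mul_zero, add_zero, smul_neg, sub_neg_eq_add, neg_smul, mul_neg, neg_mul]
  rw [mul_comm (formU x d) (ξ (tIdx n))]
  ring

lemma sum_casKer (hB : ∀ v w, B v w = B w v) :
    ∑ a, ∑ b, casKer B ℓ m f x ξ (symLift x ξ (affBasis a) (affBasis b))
        (symT x (affBasis a) (affBasis b)) (affDual a) (affDual b)
      = 2 * (-2 * B (0, ξ) (0, ξ) - 4 * B (liftH x ξ (rotM x ξ)) (0, iAlphaField x)
          + 4 * ξ (tIdx n) * ℓ (0, iAlphaField x)
          - (4 * n + 6) * ℓ (0, ξ)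
          + 2 * m * (ℓ (0, ξ) - 2 * ξ (tIdx n) * ℓ (0, iAlphaField x))
          + ((2 * n + 2) * m - m ^ 2) * f) := by
  have hone : ∀ b d, ∑ a, (formU x (affBasis a)
        * casKer B ℓ m f x ξ (liftH x ξ b) (formT n b) (affDual a) d
      - formM x ξ (affBasis a) * casKer B ℓ m f x ξ (liftD n b) 0 (affDual a) d)
      = casKer B ℓ m f x ξ (liftH x ξ b) (formT n b) (rotU x) d
        - casKer B ℓ m f x ξ (liftD n b) 0 (rotM x ξ) d := fun b d => by
    rw [Finset.sum_sub_distrib]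
    exact congrArg₂ (· - ·)
      (sum_affForm_mul_affDual _ _ (casKerLin B ℓ m f x ξ (liftH x ξ b) (formT n b) d))
      (sum_affForm_mul_affDual _ _ (casKerLin B ℓ m f x ξ (liftD n b) 0 d))
  have htwo : ∑ b, (casKer B ℓ m f x ξ (liftH x ξ (affBasis b)) (formT n (affBasis b)) (rotU x)
          (affDual b)
        - casKer B ℓ m f x ξ (liftD n (affBasis b)) 0 (rotM x ξ) (affDual b))
      = -2 * B (0, ξ) (0, ξ) - 4 * B (liftH x ξ (rotM x ξ)) (0, iAlphaField x)
          + 4 * ξ (tIdx n) * ℓ (0, iAlphaField x)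
          - (4 * n + 6) * ℓ (0, ξ)
          + 2 * m * (ℓ (0, ξ) - 2 * ξ (tIdx n) * ℓ (0, iAlphaField x))
          + ((2 * n + 2) * m - m ^ 2) * f := by
    let R : Vc n × Vc n →ₗ[ℝ] Vc n × Vc n := (-LinearMap.id).prodMap LinearMap.id
    have hR : ∀ v : Vc n × Vc n, (-v.1, v.2) = R v := fun v => rfl
    let Ψ₁ : Vc n × ℝ →ₗ[ℝ] ℝ := (B.flip (0, ξ) + ℓ ∘ₗ R - m • ℓ) ∘ₗ liftH x ξ
      + (m ^ 2 * f - m * ℓ (0, ξ)) • formT n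
      + ((ξ (tIdx n) - m * ξ (tIdx n)) • ℓ - B.flip (liftH x ξ (rotM x ξ))) ∘ₗ liftD n
    let Ψ₂ : Vc n × ℝ →ₗ[ℝ] ℝ := -(B.flip (liftD n (rotU x))) ∘ₗ liftH x ξ
      + ((m - 1) * ℓ (liftD n (rotU x))) • formT n - B.flip (0, ξ) ∘ₗ liftD n
    let Ψ₃ : Vc n × ℝ →ₗ[ℝ] ℝ := -ℓ ∘ₗ liftH x ξ + (m * f) • formT n
      + ξ (tIdx n) • ℓ ∘ₗ liftD n
    let Ψ₄ : Vc n × ℝ →ₗ[ℝ] ℝ := ℓ (liftD n (rotU x)) • formT n + (2 : ℝ) • ℓ ∘ₗ liftD n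
    have hsplit : ∀ b d, casKer B ℓ m f x ξ (liftH x ξ b) (formT n b) (rotU x) d
        - casKer B ℓ m f x ξ (liftD n b) 0 (rotM x ξ) d
        = formU x d * Ψ₁ b + formM x ξ d * Ψ₂ b + formU x b * Ψ₃ d + formM x ξ b * Ψ₄ d
          + (ℓ (0, ξ) - m * f) * (affineField b.1 b.2 x ⬝ᵥ d.1)
          - ℓ (0, ξ) * (affineField d.1 d.2 x ⬝ᵥ b.1) := fun b d => by
      rw [casKer_rotU, casKer_rotM, hR]
      simp only [Ψ₁, Ψ₂, Ψ₃, Ψ₄, LinearMap.add_apply, LinearMap.sub_apply, LinearMap.neg_apply,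
        LinearMap.smul_apply, LinearMap.comp_apply, LinearMap.flip_apply, map_add, map_sub,
        map_smul, smul_eq_mul]
      ring
    simp only [hsplit, Finset.sum_add_distrib, Finset.sum_sub_distrib, ← Finset.mul_sum,
      sum_affField_affBasis, sum_affField_affDual]
    have s1 : ∑ b, formU x (affDual b) * Ψ₁ (affBasis b) = -Ψ₁ (rotU x) :=
      sum_affForm_affDual_mul _ _ Ψ₁
    have s2 : ∑ b, formM x ξ (affDual b) * Ψ₂ (affBasis b) = -Ψ₂ (rotM x ξ) :=
      sum_affForm_affDual_mul _ _ Ψ₂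
    have s3 : ∑ b, formU x (affBasis b) * Ψ₃ (affDual b) = Ψ₃ (rotU x) :=
      sum_affForm_mul_affDual _ _ Ψ₃
    have s4 : ∑ b, formM x ξ (affBasis b) * Ψ₄ (affDual b) = Ψ₄ (rotM x ξ) :=
      sum_affForm_mul_affDual _ _ Ψ₄
    have hR0 : R (0, ξ) = (0, ξ) := by simp [R]
    rw [s1, s2, s3, s4]
    simp only [Ψ₁, Ψ₂, Ψ₃, Ψ₄, LinearMap.add_apply, LinearMap.sub_apply, LinearMap.neg_apply,
      LinearMap.smul_apply, LinearMap.comp_apply, LinearMap.flip_apply, liftH_rotU, liftD_rotU,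
      liftD_rotM, formT_rotU, formT_rotM, hR0, map_smul, map_neg, smul_eq_mul,
      hB (0, iAlphaField x)]
    ring
  have hsymm : ∑ a, ∑ b, (formU x (affBasis b)
        * casKer B ℓ m f x ξ (liftH x ξ (affBasis a)) (formT n (affBasis a)) (affDual a) (affDual b)
      - formM x ξ (affBasis b)
        * casKer B ℓ m f x ξ (liftD n (affBasis a)) 0 (affDual a) (affDual b))
      = ∑ b, ∑ a, (formU x (affBasis a)
        * casKer B ℓ m f x ξ (liftH x ξ (affBasis b)) (formT n (affBasis b)) (affDual a) (affDual b)
      - formM x ξ (affBasis a)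
        * casKer B ℓ m f x ξ (liftD n (affBasis b)) 0 (affDual a) (affDual b)) := by
    simp only [casKer_comm B ℓ m f x ξ _ _ (affDual _) (affDual _)]
  simp only [casKer_symLift, Finset.sum_add_distrib]
  rw [hsymm, Finset.sum_comm]
  simp only [hone]
  rw [htwo]
  ring

end Kernel

section Casimir
variable {n : ℕ}

/-- The product of two affine functions. -/
def mulFn (a b : Vc n × ℝ) (x : Vc n) : ℝ := affineFn a.1 a.2 x * affineFn b.1 b.2 x

lemma Lgen_mulFn_comp {k : ℕ} {δ : ℝ} {S : Vc n → Vc n → ℝ}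
    (hS : ContDiff ℝ (⊤ : ℕ∞) (fun z : Vc n × Vc n => S z.1 z.2)) (x ξ : Vc n)
    (a b c d : Vc n × ℝ) :
    Lgen n k δ (mulFn a b) (Lgen n k δ (mulFn c d) S) x ξ
      = casKer ((ContinuousLinearMap.coeLM ℝ).comp
          (fderiv ℝ (fderiv ℝ (fun z : Vc n × Vc n => S z.1 z.2)) (x, ξ)).toLinearMap)
        (fderiv ℝ (fun z : Vc n × Vc n => S z.1 z.2) (x, ξ)).toLinearMap
        (2 * ((n + 1) * δ + k)) (S x ξ) x ξ (symLift x ξ a b) (symT x a b) c d := by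
  refine (Lgen_mul_comp k δ a.1 b.1 c.1 d.1 a.2 b.2 c.2 d.2 hS x ξ).trans ?_
  have hL : ∀ a b : Vc n × ℝ, genLift a.1 a.2 b.1 b.2 (x, ξ) = symLift x ξ a b :=
    fun a b => genLift_eq a b x ξ
  have hD : ∀ w, genLiftDeriv c.1 c.2 d.1 d.2 (x, ξ) w = symLiftDeriv x ξ c d w :=
    genLiftDeriv_eq c d x ξ
  simp only [hL, hD, affineFn_eq_formU, ← formT_apply, casKer, symT, map_sub, map_smul,
    smul_eq_mul, affForm_apply, dotProduct_comm c.1, dotProduct_comm d.1, LinearMap.comp_apply,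
    ContinuousLinearMap.coe_coe, ContinuousLinearMap.coeLM_apply]
  ring

lemma sum_sum_eq_diag_add {f : Fin n → Fin n → ℝ} (hf : ∀ i j, f i j = f j i) :
    ∑ i, ∑ j, f i j = ∑ i, f i i + 2 * ∑ i, ∑ j, if i < j then f i j else 0 := by
  have h : ∀ i j, f i j = (if i = j then f i j else 0) + (if i < j then f i j else 0)
      + (if j < i then f j i else 0) := fun i j => by
    rcases lt_trichotomy i j with h | h | h
    · simp [h, h.ne, h.not_gt]
    · simp [h]
    · simp [h, h.ne', h.not_gt, hf i j]
  rw [Finset.sum_congr rfl fun i _ => Finset.sum_congr rfl fun j _ => h i j]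
  simp only [Finset.sum_add_distrib]
  rw [Finset.sum_comm (f := fun i j => if j < i then f j i else 0)]
  simp
  ring

lemma casimirOp_eq_sum {k : ℕ} {δ : ℝ} {S : Vc n → Vc n → ℝ} {x ξ : Vc n}
    {Q : Vc n × ℝ → Vc n × ℝ → Vc n × ℝ → Vc n × ℝ → ℝ}
    (hQ : ∀ a b c d, Lgen n k δ (mulFn a b) (Lgen n k δ (mulFn c d) S) x ξ = Q a b c d)
    (hneg : ∀ a b c d, Q a b (-c) d = -Q a b c d) :
    casimirOp n k δ S x ξ = -(1 / (8 * ((n : ℝ) + 2)))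
      * ∑ a, ∑ b, Q (affBasis a) (affBasis b) (affDual a) (affDual b) := by
  have hcomm : ∀ a b : Vc n × ℝ, mulFn a b = mulFn b a := fun a b => by
    funext y; simp only [mulFn]; ring
  have h₁ : ∀ a b c d, Q a b c d = Q b a c d := fun a b c d => by
    rw [← hQ, ← hQ, hcomm a b]
  have h₂ : ∀ a b c d, Q a b c d = Q a b d c := fun a b c d => by
    rw [← hQ, ← hQ, hcomm c d]
  have hneg' : ∀ a b c d, Q a b c (-d) = -Q a b c d := fun a b c d => by
    rw [h₂, hneg, h₂]
  have e₁ : (fun _ => 1 : Vc n → ℝ) = mulFn (affBasis (false, none)) (affBasis (false, none)) := by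
    funext y; simp [mulFn, affBasis, affineFn]
  have et : (fun y => y (tIdx n) : Vc n → ℝ)
      = mulFn (affBasis (true, none)) (affBasis (false, none)) := by
    funext y; simp [mulFn, affBasis, affineFn]
  have ett : (fun y => y (tIdx n) * y (tIdx n) : Vc n → ℝ)
      = mulFn (affBasis (true, none)) (affBasis (true, none)) := by
    funext y; simp [mulFn, affBasis, affineFn]
  have ep : ∀ i, (fun y => y (pIdx n i) : Vc n → ℝ)
      = mulFn (affBasis (true, some i)) (affBasis (false, none)) := fun i => by
    funext y; simp [mulFn, affBasis, affineFn]
  have eq : ∀ i, (fun y => y (qIdx n i) : Vc n → ℝ)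
      = mulFn (affBasis (false, some i)) (affBasis (false, none)) := fun i => by
    funext y; simp [mulFn, affBasis, affineFn]
  have etp : ∀ i, (fun y => y (tIdx n) * y (pIdx n i) : Vc n → ℝ)
      = mulFn (affBasis (true, none)) (affBasis (true, some i)) := fun i => by
    funext y; simp [mulFn, affBasis, affineFn]
  have etq : ∀ i, (fun y => y (tIdx n) * y (qIdx n i) : Vc n → ℝ)
      = mulFn (affBasis (true, none)) (affBasis (false, some i)) := fun i => by
    funext y; simp [mulFn, affBasis, affineFn]
  have epp : ∀ i j, (fun y => y (pIdx n i) * y (pIdx n j) : Vc n → ℝ)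
      = mulFn (affBasis (true, some i)) (affBasis (true, some j)) := fun i j => by
    funext y; simp [mulFn, affBasis, affineFn]
  have eqq : ∀ i j, (fun y => y (qIdx n i) * y (qIdx n j) : Vc n → ℝ)
      = mulFn (affBasis (false, some i)) (affBasis (false, some j)) := fun i j => by
    funext y; simp [mulFn, affBasis, affineFn]
  have epq : ∀ i j, (fun y => y (pIdx n i) * y (qIdx n j) : Vc n → ℝ)
      = mulFn (affBasis (true, some i)) (affBasis (false, some j)) := fun i j => by
    funext y; simp [mulFn, affBasis, affineFn]
  have hdiag := sum_sum_eq_diag_add (n := n) (f := fun i j =>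
    Q (affBasis (false, some i)) (affBasis (false, some j)) (affBasis (true, some i))
        (affBasis (true, some j))
      + Q (affBasis (true, some i)) (affBasis (true, some j)) (affBasis (false, some i))
        (affBasis (false, some j))) fun i j => 
    congrArg₂ (· + ·) ((h₁ _ _ _ _).trans (h₂ _ _ _ _)) ((h₁ _ _ _ _).trans (h₂ _ _ _ _))
  have hn : (n : ℝ) + 2 ≠ 0 := by positivity
  simp only [casimirOp, e₁, et, ett, ep, eq, etp, etq, epp, eqq, epq, hQ]
  have s₁ : ∀ o o' c d, Q (affBasis (false, o)) (affBasis (true, o')) c d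
      = Q (affBasis (true, o')) (affBasis (false, o)) c d := fun _ _ => h₁ _ _
  have s₂ : ∀ a b o o', Q a b (affBasis (false, o)) (affBasis (true, o'))
      = Q a b (affBasis (true, o')) (affBasis (false, o)) := fun a b _ _ => h₂ a b _ _
  have s₃ : ∀ i c d, Q (affBasis (true, some i)) (affBasis (true, none)) c d
      = Q (affBasis (true, none)) (affBasis (true, some i)) c d := fun _ => h₁ _ _
  have s₄ : ∀ i c d, Q (affBasis (false, none)) (affBasis (false, some i)) c d
      = Q (affBasis (false, some i)) (affBasis (false, none)) c d := fun _ => h₁ _ _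
  have s₅ : ∀ a b i, Q a b (affBasis (true, some i)) (affBasis (true, none))
      = Q a b (affBasis (true, none)) (affBasis (true, some i)) := fun a b _ => h₂ a b _ _
  have s₆ : ∀ a b i, Q a b (affBasis (false, none)) (affBasis (false, some i))
      = Q a b (affBasis (false, some i)) (affBasis (false, none)) := fun a b _ => h₂ a b _ _
  have hpq := Finset.sum_comm (s := Finset.univ) (t := Finset.univ) (f := fun i j : Fin n =>
    Q (affBasis (true, some j)) (affBasis (false, some i)) (affBasis (true, some i))
      (affBasis (false, some j)))
  simp only [sum_basis, affDual_true, affDual_false, hneg, hneg', Finset.sum_add_distrib,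
    s₁, s₂, s₃, s₄, s₅, s₆, Finset.sum_neg_distrib] at hdiag ⊢
  rw [hpq]
  field_simp
  linarith

lemma half_spRot_genHamField (x ξ : Vc n) :
    (1 / 2 : ℝ) • spRot (genHamField x ξ) = (1 / 2 : ℝ) • ξ + ξ (tIdx n) • iAlphaField x := by
  simp only [genHamField, iAlphaField, spRot_sub, spRot_add, spRot_neg, spRot_spRot, spRot_smul,
    spRot_single_tIdx]
  module

end Casimir

/-- For `δ ∉ 𝒞_k`, the Casimir operator of `sp_{2n+2}` on `R^k_δ` is
`C^k_δ = (1/(n+2))(c(k,δ) id + X ∘ i_α)` with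
`c(k,δ) = (n+1)²δ² − (n+1)²δ + k(n+1)δ + (k²−k)/2`. -/
theorem stmt10 (n : ℕ) (hn : 1 ≤ n) (k : ℕ) (δ : ℝ)
    (hδ : ∀ p : ℕ, (p : ℤ) ≤ 2*(k : ℤ) - 2 → δ ≠ -(p : ℝ)/(2*((n : ℝ)+1)))
    (S : Vc n → Vc n → ℝ) (hS : InR n k S) (x ξ : Vc n) :
    casimirOp n k δ S x ξ
      = (1/((n:ℝ)+2)) * ((((n:ℝ)+1)^2*δ^2 - ((n:ℝ)+1)^2*δ + (k:ℝ)*((n:ℝ)+1)*δ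
            + ((k:ℝ)^2 - (k:ℝ))/2) * S x ξ
          + genHam n (2*((n:ℝ)+1)*δ + ((k:ℝ) - 1)) (iAlpha n S) x ξ) := by
  have hneg : ∀ (B : Vc n × Vc n →ₗ[ℝ] Vc n × Vc n →ₗ[ℝ] ℝ) (ℓ : Vc n × Vc n →ₗ[ℝ] ℝ)
      (m f : ℝ) (a b c d : Vc n × ℝ),
      casKer B ℓ m f x ξ (symLift x ξ a b) (symT x a b) (-c) d
        = -casKer B ℓ m f x ξ (symLift x ξ a b) (symT x a b) c d :=
    fun B ℓ m f a b c d => map_neg (casKerLin B ℓ m f x ξ _ _ d) c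
  rw [casimirOp_eq_sum (Lgen_mulFn_comp hS.1 x ξ) (hneg _ _ _ _), sum_casKer, genHam_iAlpha _ hS.1]
  swap
  · exact fun v w => sndDeriv_symm hS.1 (x, ξ) v w
  have hn2 : (n : ℝ) + 2 ≠ 0 := by positivity
  simp only [LinearMap.comp_apply, ContinuousLinearMap.coe_coe, ContinuousLinearMap.coeLM_apply]
  have e₁ := euler_fst hS (x, ξ)
  have e₂ := euler_snd hS (x, ξ) (0, ξ)
  have e₃ := euler_snd hS (x, ξ) (0, iAlphaField x)
  rw [sndDeriv_symm hS.1] at e₃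
  set ℓ := fderiv ℝ (fun z : Vc n × Vc n => S z.1 z.2) (x, ξ)
  set B := fderiv ℝ (fderiv ℝ (fun z : Vc n × Vc n => S z.1 z.2)) (x, ξ)
  have hg : liftH x ξ (rotM x ξ) = (genHamField x ξ, 0) - ξ (tIdx n) • (0, ξ) := by
    rw [liftH_rotM]; simp
  have hv : ((0, (1 / 2 : ℝ) • spRot (genHamField x ξ)
      + ((2 * ((n : ℝ) + 1) * δ + ((k : ℝ) - 1)) * ξ (tIdx n)) • iAlphaField x) : Vc n × Vc n)
      = (1 / 2 : ℝ) • (0, ξ)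
        + ((2 * ((n : ℝ) + 1) * δ + k) * ξ (tIdx n)) • (0, iAlphaField x) := by
    rw [half_spRot_genHamField]
    refine Prod.ext (by simp) ?_
    simp only [Prod.snd_add, Prod.smul_snd]
    module
  rw [hv, hg]
  simp only [map_add, map_sub, map_smul, sub_apply, smul_apply,
    smul_eq_mul, e₂, e₃, e₁]
  field_simp
  ring
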